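/- The supremum sup{s > 0 : P^(s) ≠ ∅} is attained and is a positive rational number; it also equals sup{s > 0 : dim P^(s) = n}. Moreover, μ(P) = min{p/q : p, q ∈ ℤ_{>0} and (pP)^(q) contains a point of ℤ^n}, and the core core(P) := P^(1/μ(P)) is a rational polytope of dimension strictly less than n. -/

import Mathlib

open scoped BigOperators Pointwise

noncomputable section

/-- Pairing `⟨a, x⟩ = ∑ aⱼ xⱼ` of an integer linear functional with a real point. -/
def ipair {n : ℕ} (a : Fin n → ℤ) (x : Fin n → ℝ) : ℝ := ∑ j, (a j : ℝ) * x j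

/-- An integer vector is primitive if it is nonzero and not a nontrivial integer
multiple of another integer vector. -/
def IsPrimitive {n : ℕ} (a : Fin n → ℤ) : Prop :=
  a ≠ 0 ∧ ∀ (k : ℤ) (b : Fin n → ℤ), a = k • b → IsUnit k

/-- The set of integer (lattice) points of `ℝⁿ`. -/
def IntPts (n : ℕ) : Set (Fin n → ℝ) := Set.range (fun z : Fin n → ℤ => fun j => (z j : ℝ))

/-- The dimension of a subset of `ℝⁿ` (the dimension of its affine hull). -/
def setDim {n : ℕ} (S : Set (Fin n → ℝ)) : ℕ := Module.finrank ℝ (vectorSpan ℝ S)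

/-- An irredundant facet description `P = {x : A x ≥ b}` of an `n`-dimensional
rational polytope: the rows `aᵢ` of `A` are primitive integer vectors, the right hand
sides are rational, `P` is bounded and `n`-dimensional, every inequality defines a facet
(a face of dimension `n-1`), and no inequality is repeated. -/
structure PolyDesc (n m : ℕ) : Type where
  hm : 0 < m
  A : Fin m → Fin n → ℤ
  b : Fin m → ℚ
  prim : ∀ i, IsPrimitive (A i)
  bounded : Bornology.IsBounded {x : Fin n → ℝ | ∀ i, (b i : ℝ) ≤ ipair (A i) x}
  fulldim : setDim {x : Fin n → ℝ | ∀ i, (b i : ℝ) ≤ ipair (A i) x} = n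
  facet_dim : ∀ i, setDim {x : Fin n → ℝ |
      (∀ j, (b j : ℝ) ≤ ipair (A j) x) ∧ ipair (A i) x = (b i : ℝ)} + 1 = n
  irredundant : Function.Injective (fun i => (A i, b i))

namespace PolyDesc

variable {n m : ℕ} (D : PolyDesc n m)

/-- The polytope `P` itself. -/
def pts : Set (Fin n → ℝ) := {x | ∀ i, (D.b i : ℝ) ≤ ipair (D.A i) x}

/-- Lattice distance `d_{Fᵢ}(x) = ⟨aᵢ, x⟩ - bᵢ` from (the hyperplane spanned by)
the `i`-th facet. -/
def dF (i : Fin m) (x : Fin n → ℝ) : ℝ := ipair (D.A i) x - (D.b i : ℝ)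

/-- Lattice distance `d_P(x) = minᵢ d_{Fᵢ}(x)` from the boundary of `P`. -/
def dist (x : Fin n → ℝ) : ℝ :=
  Finset.univ.inf'
    (Finset.univ_nonempty_iff.mpr (Fin.pos_iff_nonempty.mp D.hm))
    (fun i => D.dF i x)

/-- The adjoint polytope `P⁽ˢ⁾ = {x : d_P(x) ≥ s}`. -/
def adj (s : ℝ) : Set (Fin n → ℝ) := {x | s ≤ D.dist x}

/-- The `i`-th facet `Fᵢ` of `P`. -/
def facet (i : Fin m) : Set (Fin n → ℝ) := {x ∈ D.pts | ipair (D.A i) x = (D.b i : ℝ)}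

/-- The set `{s > 0 : P⁽ˢ⁾ ≠ ∅}`, whose supremum is `μ(P)⁻¹`. -/
def qcdInvSet : Set ℝ := {s : ℝ | 0 < s ∧ (D.adj s).Nonempty}

/-- `μ(P)⁻¹ = sup {s > 0 : P⁽ˢ⁾ ≠ ∅}`. -/
def qcdInv : ℝ := sSup D.qcdInvSet

/-- The ℚ-codegree `μ(P) = (sup {s > 0 : P⁽ˢ⁾ ≠ ∅})⁻¹`. -/
def qcd : ℝ := D.qcdInv⁻¹

/-- The core `core(P) = P^{(1/μ(P))}`. -/
def core : Set (Fin n → ℝ) := D.adj D.qcdInv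

/-- The codegree `cd(P) = min {k ∈ ℕ, k ≥ 1 : int(kP) ∩ ℤⁿ ≠ ∅}`. -/
def codeg : ℕ := sInf {k : ℕ | 0 < k ∧
  ∃ z : Fin n → ℤ, (fun j => (z j : ℝ)) ∈ interior ((k : ℝ) • D.pts)}

end PolyDesc

/-- The face of `S` on which the linear functional `u` is maximized. -/
def argFace {n : ℕ} (S : Set (Fin n → ℝ)) (u : Fin n → ℝ) : Set (Fin n → ℝ) :=
  {x ∈ S | ∀ y ∈ S, ∑ j, u j * y j ≤ ∑ j, u j * x j}

/-- `S` and `T` have the same normal fan: two linear functionals lie in the same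
(relatively open) cone of the normal fan of `S`, i.e. are maximized on the same face
of `S`, iff the same holds for `T`. -/
def SameNormalFan {n : ℕ} (S T : Set (Fin n → ℝ)) : Prop :=
  ∀ u v : Fin n → ℝ, (argFace S u = argFace S v ↔ argFace T u = argFace T v)

/-- The normal fan of `S` refines the normal fan of `T`. -/
def RefinesNormalFan {n : ℕ} (S T : Set (Fin n → ℝ)) : Prop :=
  ∀ u v : Fin n → ℝ, argFace S u = argFace S v → argFace T u = argFace T v

namespace PolyDesc
variable {n m : ℕ} (D : PolyDesc n m)

/-- `{s > 0 : N(P⁽ˢ⁾) = N(P)}`, whose supremum is `τ(P)⁻¹`. -/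
def nefInvSet : Set ℝ := {s : ℝ | 0 < s ∧ SameNormalFan (D.adj s) D.pts}

/-- `τ(P)⁻¹ = sup {s > 0 : N(P⁽ˢ⁾) = N(P)}`. -/
def nefInv : ℝ := sSup D.nefInvSet

/-- The nef value `τ(P)`. -/
def nefVal : ℝ := D.nefInv⁻¹

/-- The set of inequalities active at `x`; the normal cone of the minimal face of `P`
containing `x` is generated by `{aᵢ : i ∈ active x}`, and all cones of the normal fan
of `P` arise in this way. -/
def active (x : Fin n → ℝ) : Set (Fin m) := {i | ipair (D.A i) x = (D.b i : ℝ)}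

/-- The normal cone at the vertex `v` is ℚ-Gorenstein of index `r`, witnessed by the
primitive lattice point `u = u_σ` with `⟨aᵢ, u⟩ = r` for all active `i`. -/
def VertexQG (v : Fin n → ℝ) (u : Fin n → ℤ) (r : ℤ) : Prop :=
  IsPrimitive u ∧ 0 < r ∧ ∀ i ∈ D.active v, (∑ j, D.A i j * u j) = r

/-- The normal fan of `P` is ℚ-Gorenstein: every maximal cone (normal cone of a
vertex, i.e. of an extreme point) is ℚ-Gorenstein. -/
def QGorenstein : Prop := ∀ v ∈ Set.extremePoints ℝ D.pts, ∃ u r, D.VertexQG v u r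

end PolyDesc

/-- The point `v(s) = v + (s/r_σ) • u_σ`. -/
def vmove {n : ℕ} (v : Fin n → ℝ) (s : ℝ) (u : Fin n → ℤ) (r : ℤ) : Fin n → ℝ :=
  v + (s / (r : ℝ)) • (fun j => ((u j : ℝ)))

/-- The height of a point `y` in the cone generated by `{aᵢ : i ∈ I}`:
`ht(y) = max {∑ λᵢ : λᵢ ≥ 0, ∑ λᵢ aᵢ = y}`. -/
def coneHeight {n m : ℕ} (D : PolyDesc n m) (I : Set (Fin m)) (y : Fin n → ℝ) : ℝ :=
  sSup {t : ℝ | ∃ c : Fin m → ℝ, (∀ i, 0 ≤ c i) ∧ (∀ i ∉ I, c i = 0) ∧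
    (y = ∑ i, c i • (fun j => ((D.A i j : ℝ)))) ∧ t = ∑ i, c i}

/-- `P` is α-canonical: for every cone `σ` of the normal fan of `P` (the normal cone
of the minimal face containing a point `x ∈ P`, generated by `{aᵢ : i ∈ active x}`),
every nonzero lattice point of `σ` has height at least `α`. -/
def AlphaCanonical {n m : ℕ} (D : PolyDesc n m) (α : ℝ) : Prop :=
  ∀ x ∈ D.pts, ∀ z : Fin n → ℤ, z ≠ 0 →
    (∃ c : Fin m → ℝ, (∀ i, 0 ≤ c i) ∧ (∀ i ∉ D.active x, c i = 0) ∧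
      ((fun j => ((z j : ℝ))) = ∑ i, c i • (fun j => ((D.A i j : ℝ))))) →
    α ≤ coneHeight D (D.active x) (fun j => ((z j : ℝ)))

/-- `P` is a lattice polytope: the convex hull of finitely many integer points. -/
def IsLatticePoly {n : ℕ} (P : Set (Fin n → ℝ)) : Prop :=
  ∃ V : Finset (Fin n → ℤ),
    P = convexHull ℝ ((fun z : Fin n → ℤ => fun j => ((z j : ℝ))) '' (V : Set (Fin n → ℤ)))

/-- The `i`-th standard basis vector of `ℝᵗ`. -/
def stdBasisVec (t : ℕ) (i : Fin t) : Fin t → ℝ := fun j => if j = i then 1 else 0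

/-- The marking vectors of a Cayley sum: `0, e₁, …, e_t ∈ ℝᵗ`. -/
def cayleyVec (t : ℕ) : Fin (t + 1) → (Fin t → ℝ) :=
  fun j => if h : (j : ℕ) = 0 then 0 else stdBasisVec t ⟨(j : ℕ) - 1, by have := j.isLt; omega⟩

/-- The Cayley sum `Q₀ * ⋯ * Q_t = conv((Q₀ × {0}) ∪ (Q₁ × {e₁}) ∪ ⋯ ∪ (Q_t × {e_t}))`. -/
def cayleySum {k t : ℕ} (Q : Fin (t + 1) → Set (Fin k → ℝ)) :
    Set ((Fin k → ℝ) × (Fin t → ℝ)) :=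
  convexHull ℝ (⋃ j, (Q j) ×ˢ ({cayleyVec t j} : Set (Fin t → ℝ)))

/-- `P ⊆ ℝⁿ` is a Cayley polytope `P₀ * ⋯ * P_t` of length `t+1` of lattice polytopes
`Pⱼ ⊆ ℝᵏ` with `k + t = n`: some affine lattice isomorphism `ℤⁿ ≅ ℤᵏ × ℤᵗ`
identifies `P` with such a Cayley sum. -/
def IsCayley {n : ℕ} (P : Set (Fin n → ℝ)) (k t : ℕ) : Prop :=
  k + t = n ∧
  ∃ Q : Fin (t + 1) → Finset (Fin k → ℤ), (∀ j, (Q j).Nonempty) ∧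
  ∃ f : (Fin n → ℝ) ≃ᵃ[ℝ] (Fin k → ℝ) × (Fin t → ℝ),
    f '' IntPts n = (IntPts k) ×ˢ (IntPts t) ∧
    f '' P = cayleySum (fun j =>
      convexHull ℝ ((fun z : Fin k → ℤ => fun i => ((z i : ℝ))) '' (Q j : Set (Fin k → ℤ))))

/-- The unimodular simplex `Δₙ = conv(0, e₁, …, eₙ)`. -/
def unimodSimplex (n : ℕ) : Set (Fin n → ℝ) :=
  convexHull ℝ (insert (0 : Fin n → ℝ) (Set.range (stdBasisVec n)))

/-- Two subsets of `ℝⁿ` are unimodularly equivalent: an affine lattice automorphism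
maps one onto the other. -/
def UnimodEquiv {n : ℕ} (P P' : Set (Fin n → ℝ)) : Prop :=
  ∃ f : (Fin n → ℝ) ≃ᵃ[ℝ] (Fin n → ℝ), f '' IntPts n = IntPts n ∧ f '' P = P'

/-- The codegree `cd(P) = min {k ∈ ℕ, k ≥ 1 : int(kP) ∩ ℤⁿ ≠ ∅}` of a polytope given
as a set. -/
def codegS {n : ℕ} (P : Set (Fin n → ℝ)) : ℕ :=
  sInf {k : ℕ | 0 < k ∧ ∃ z : Fin n → ℤ, (fun j => (z j : ℝ)) ∈ interior ((k : ℝ) • P)}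

/-- `P` has lattice width one: some nonzero integer linear functional has minimum `c`
and maximum `c + 1` on `P`. -/
def HasLatticeWidthOne {n : ℕ} (P : Set (Fin n → ℝ)) : Prop :=
  ∃ u : Fin n → ℤ, u ≠ 0 ∧ ∃ c : ℤ,
    (∀ x ∈ P, (c : ℝ) ≤ ipair u x ∧ ipair u x ≤ (c : ℝ) + 1) ∧
    (∃ x ∈ P, ipair u x = (c : ℝ)) ∧ (∃ x ∈ P, ipair u x = (c : ℝ) + 1)

/-- `P` is a lattice pyramid: for some primitive `u`, `P` is the convex hull of a base
lying in the lattice hyperplane `{⟨u, ·⟩ = c}` and an apex at lattice distance one from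
it (this is equivalent to being unimodularly equivalent to
`conv((Q × {0}) ∪ {(0, …, 0, 1)})` for an `(n-1)`-dimensional lattice polytope `Q`). -/
def IsLatticePyramid {n : ℕ} (P : Set (Fin n → ℝ)) : Prop :=
  ∃ u : Fin n → ℤ, IsPrimitive u ∧ ∃ c : ℤ, ∃ apex ∈ P,
    ipair u apex = (c : ℝ) + 1 ∧
    P = convexHull ℝ ({x ∈ P | ipair u x = (c : ℝ)} ∪ {apex})

/-- `F` is a facet of `S`: an exposed face of dimension `dim S - 1`. -/
def IsFacetOf {n : ℕ} (F S : Set (Fin n → ℝ)) : Prop :=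
  IsExposed ℝ S F ∧ F.Nonempty ∧ setDim F + 1 = setDim S

/-- The polyhedron `{x : A x ≥ c}` cut out by rational inequalities. -/
def ratPolyhedron {ι κ : Type*} [Fintype κ] (a : ι → κ → ℚ) (c : ι → ℚ) : Set (κ → ℝ) :=
  {x | ∀ i, (c i : ℝ) ≤ ∑ j, (a i j : ℝ) * x j}

theorem exists_rat_eq_of_injective {ι κ : Type*} [Fintype ι] [Fintype κ] (A : Matrix ι κ ℚ)
    (c : ι → ℚ) (x : κ → ℝ) (hx : ∀ i, ∑ j, (A i j : ℝ) * x j = c i)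
    (hA : ∀ d : κ → ℚ, A.mulVec d = 0 → d = 0) :
    ∃ v : κ → ℚ, (fun j => (v j : ℝ)) = x := by
  classical
  obtain ⟨g, hg⟩ := A.mulVecLin.exists_leftInverse_of_injective
    (LinearMap.ker_eq_bot'.mpr fun d hd => hA d hd)
  let B : Matrix κ ι ℚ := LinearMap.toMatrix' g
  have hBA : B * A = 1 := by
    rw [← LinearMap.toMatrix'_id, ← hg, LinearMap.toMatrix'_comp]
    congr 1
    exact (LinearMap.toMatrix'_toLin' A).symm
  refine ⟨fun k => ∑ i, B k i * c i, funext fun k => ?_⟩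
  have hk : ∀ j, ∑ i, (B k i : ℝ) * (A i j : ℝ) = if k = j then 1 else 0 := by
    intro j
    have h := congrFun (congrFun hBA k) j
    rw [Matrix.mul_apply, Matrix.one_apply] at h
    have h' := congrArg (fun q : ℚ => (q : ℝ)) h
    simpa [apply_ite (Rat.cast : ℚ → ℝ)] using h'
  push_cast
  calc ∑ i, (B k i : ℝ) * (c i : ℝ)
      = ∑ i, ∑ j, (B k i : ℝ) * (A i j : ℝ) * x j := by
        refine Finset.sum_congr rfl fun i _ => ?_
        rw [← hx i, Finset.mul_sum]
        exact Finset.sum_congr rfl fun j _ => by ring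
    _ = ∑ j, (∑ i, (B k i : ℝ) * (A i j : ℝ)) * x j := by
        rw [Finset.sum_comm]
        exact Finset.sum_congr rfl fun j _ => by rw [Finset.sum_mul]
    _ = x k := by simp [hk]

namespace ratPolyhedron

variable {ι κ : Type*} [Fintype κ] {a : ι → κ → ℚ} {c : ι → ℚ}

theorem isClosed : IsClosed (ratPolyhedron a c) := by
  simp only [ratPolyhedron, Set.ofPred_forall]
  exact isClosed_iInter fun i => isClosed_le continuous_const (by fun_prop)

theorem convex : Convex ℝ (ratPolyhedron a c) := by
  intro x hx y hy s t hs ht hst i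
  have h : ∑ j, (a i j : ℝ) * (s • x + t • y) j
      = s * ∑ j, (a i j : ℝ) * x j + t * ∑ j, (a i j : ℝ) * y j := by
    simp only [Finset.mul_sum, ← Finset.sum_add_distrib, Pi.add_apply, Pi.smul_apply, smul_eq_mul]
    exact Finset.sum_congr rfl fun j _ => by ring
  rw [h]
  have h1 := mul_le_mul_of_nonneg_left (hx i) hs
  have h2 := mul_le_mul_of_nonneg_left (hy i) ht
  have h3 : (c i : ℝ) = s * c i + t * c i := by rw [← add_mul, hst, one_mul]
  linarith

/-- At an extreme point the active constraints have trivial common kernel. -/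
theorem eq_zero_of_mem_extremePoints [Finite ι] {x : κ → ℝ}
    (hx : x ∈ (ratPolyhedron a c).extremePoints ℝ) {d : κ → ℝ}
    (hd : ∀ i, ∑ j, (a i j : ℝ) * x j = c i → ∑ j, (a i j : ℝ) * d j = 0) : d = 0 := by
  have hexp : ∀ (i : ι) (ε : ℝ), ∑ j, (a i j : ℝ) * (x + ε • d) j
      = ∑ j, (a i j : ℝ) * x j + ε * ∑ j, (a i j : ℝ) * d j := by
    intro i ε
    simp only [Finset.mul_sum, ← Finset.sum_add_distrib, Pi.add_apply, Pi.smul_apply, smul_eq_mul]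
    exact Finset.sum_congr rfl fun j _ => by ring
  have hmem : ∀ᶠ ε in nhds (0 : ℝ), x + ε • d ∈ ratPolyhedron a c := by
    simp only [ratPolyhedron, Set.mem_ofPred_eq, Filter.eventually_all]
    intro i
    by_cases hi : ∑ j, (a i j : ℝ) * x j = c i
    · refine Filter.Eventually.of_forall fun ε => ?_
      rw [hexp, hd i hi, hi, mul_zero, add_zero]
    · have hlt : (c i : ℝ) < ∑ j, (a i j : ℝ) * x j := lt_of_le_of_ne (hx.1 i) (Ne.symm hi)
      have hcont : Continuous fun ε : ℝ => ∑ j, (a i j : ℝ) * (x + ε • d) j := by fun_prop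
      have := (hcont.tendsto 0).eventually_const_lt (u := (c i : ℝ)) (by simpa using hlt)
      exact this.mono fun _ h => h.le
  have hneg : ∀ᶠ ε in nhds (0 : ℝ), x + (-ε) • d ∈ ratPolyhedron a c := by
    have ht : Filter.Tendsto (fun ε : ℝ => -ε) (nhds 0) (nhds 0) := by
      simpa using (continuous_neg (G := ℝ)).tendsto 0
    exact ht.eventually hmem
  obtain ⟨ε, ⟨h1, h2⟩, hε⟩ := ((((hmem.and hneg).filter_mono nhdsWithin_le_nhds).and
    (self_mem_nhdsWithin (s := {(0 : ℝ)}ᶜ) (a := (0 : ℝ)))).exists)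
  have hseg : x ∈ openSegment ℝ (x + ε • d) (x + (-ε) • d) :=
    ⟨1 / 2, 1 / 2, by norm_num, by norm_num, by norm_num, by
      ext j; simp only [Pi.add_apply, Pi.smul_apply, smul_eq_mul]; ring⟩
  have h := hx.2 h1 h2 hseg
  have h0 : ε • d = 0 := by simpa using h
  exact (smul_eq_zero.mp h0).resolve_left hε

theorem exists_rat_of_mem_extremePoints [Fintype ι] {x : κ → ℝ}
    (hx : x ∈ (ratPolyhedron a c).extremePoints ℝ) :
    ∃ v : κ → ℚ, (fun j => (v j : ℝ)) = x := by
  classical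
  refine exists_rat_eq_of_injective
    (fun i j => if ∑ j, (a i j : ℝ) * x j = c i then a i j else 0)
    (fun i => if ∑ j, (a i j : ℝ) * x j = c i then c i else 0) x (fun i => ?_) (fun d hd => ?_)
  · by_cases hi : ∑ j, (a i j : ℝ) * x j = c i
    · simpa only [if_pos hi] using hi
    · simp [if_neg hi]
  · have h0 : (fun j => (d j : ℝ)) = 0 := by
      refine eq_zero_of_mem_extremePoints hx fun i hi => ?_
      have h := congrFun hd i
      simp only [Matrix.mulVec, dotProduct, if_pos hi, Pi.zero_apply] at h
      exact_mod_cast congrArg (fun q : ℚ => (q : ℝ)) h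
    funext j
    have h := congrFun h0 j
    simpa using h

theorem finite_extremePoints [Finite ι] : ((ratPolyhedron a c).extremePoints ℝ).Finite := by
  refine Set.Finite.of_finite_image (f := fun x => {i | ∑ j, (a i j : ℝ) * x j = c i})
    (Set.toFinite _) fun x hx y _ hxy => ?_
  refine sub_eq_zero.mp (eq_zero_of_mem_extremePoints hx fun i hi => ?_)
  have hi' : ∑ j, (a i j : ℝ) * y j = c i := (Set.ext_iff.mp hxy i).mp hi
  simp only [Pi.sub_apply, mul_sub, Finset.sum_sub_distrib, hi, hi', sub_self]

/-- A bounded rational polyhedron is the convex hull of finitely many rational points. -/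
theorem exists_eq_convexHull [Fintype ι] (hb : Bornology.IsBounded (ratPolyhedron a c)) :
    ∃ V : Finset (κ → ℚ), ratPolyhedron a c
      = convexHull ℝ ((fun v : κ → ℚ => fun j => (v j : ℝ)) '' (V : Set (κ → ℚ))) := by
  have hinj : Function.Injective (fun v : κ → ℚ => fun j => (v j : ℝ)) := fun v w h =>
    funext fun j => Rat.cast_injective (congrFun h j)
  have hfin := (finite_extremePoints (a := a) (c := c)).preimage hinj.injOn
  refine ⟨hfin.toFinset, ?_⟩
  have hsub : (ratPolyhedron a c).extremePoints ℝ
      ⊆ Set.range (fun v : κ → ℚ => fun j => (v j : ℝ)) :=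
    fun x hx => exists_rat_of_mem_extremePoints hx
  have hclosed : IsClosed (convexHull ℝ ((ratPolyhedron a c).extremePoints ℝ)) :=
    Set.Finite.isClosed_convexHull ℝ finite_extremePoints
  rw [hfin.coe_toFinset, Set.image_preimage_eq_of_subset hsub, ← hclosed.closure_eq,
    closure_convexHull_extremePoints (Metric.isCompact_of_isClosed_isBounded isClosed hb) convex]

end ratPolyhedron

theorem continuous_ipair {n : ℕ} (a : Fin n → ℤ) : Continuous (ipair a) := by
  unfold ipair; fun_prop

theorem ipair_add_smul {n : ℕ} (a : Fin n → ℤ) (x d : Fin n → ℝ) (ε : ℝ) :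
    ipair a (x + ε • d) = ipair a x + ε * ipair a d := by
  simp only [ipair, Finset.mul_sum, ← Finset.sum_add_distrib, Pi.add_apply, Pi.smul_apply,
    smul_eq_mul]
  exact Finset.sum_congr rfl fun j _ => by ring

/-- A nonzero functional bounded below on a set is strictly above its bound on the interior. -/
theorem lt_ipair_of_mem_interior {n : ℕ} {a : Fin n → ℤ} (ha : a ≠ 0) {S : Set (Fin n → ℝ)}
    {r : ℝ} (hS : ∀ x ∈ S, r ≤ ipair a x) {y : Fin n → ℝ} (hy : y ∈ interior S) :
    r < ipair a y := by
  have hpos : 0 < ipair a (fun j => (a j : ℝ)) := by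
    obtain ⟨j, hj⟩ := Function.ne_iff.mp ha
    have hj' : (a j : ℝ) ≠ 0 := by exact_mod_cast hj
    exact Finset.sum_pos' (fun j _ => mul_self_nonneg _)
      ⟨j, Finset.mem_univ j, mul_self_pos.mpr hj'⟩
  have hcont : Continuous fun ε : ℝ => y + ε • (fun j => -(a j : ℝ)) := by fun_prop
  have hev : ∀ᶠ ε in nhds (0 : ℝ), y + ε • (fun j => -(a j : ℝ)) ∈ interior S :=
    (hcont.tendsto 0).eventually_mem (isOpen_interior.mem_nhds (by simpa using hy))
  obtain ⟨ε, h1, hε⟩ := ((hev.filter_mono nhdsWithin_le_nhds).and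
    (self_mem_nhdsWithin (s := Set.Ioi (0 : ℝ)) (a := (0 : ℝ)))).exists
  have h2 := hS _ (interior_subset h1)
  have h3 : ipair a (fun j => -(a j : ℝ)) = -ipair a (fun j => (a j : ℝ)) := by
    simp [ipair, Finset.sum_neg_distrib]
  rw [ipair_add_smul, h3] at h2
  have h4 := mul_pos (Set.mem_Ioi.mp hε) hpos
  linarith

theorem setDim_eq_of_interior_nonempty {n : ℕ} {S : Set (Fin n → ℝ)}
    (hS : (interior S).Nonempty) : setDim S = n := by
  have h := isOpen_interior.affineSpan_eq_top hS
  have h' : affineSpan ℝ S = ⊤ := top_unique (h ▸ affineSpan_mono ℝ interior_subset)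
  rw [setDim, AffineSubspace.vectorSpan_eq_top_of_affineSpan_eq_top ℝ _ _ h', finrank_top,
    Module.finrank_fin_fun]

theorem interior_nonempty_of_setDim_eq {n : ℕ} (hn : 0 < n) {S : Set (Fin n → ℝ)}
    (hc : Convex ℝ S) (hS : setDim S = n) : (interior S).Nonempty := by
  have hne : S.Nonempty := by
    by_contra h
    rw [Set.not_nonempty_iff_eq_empty] at h
    rw [h, setDim, vectorSpan_empty, finrank_bot] at hS
    omega
  rw [hc.interior_nonempty_iff_affineSpan_eq_top,
    AffineSubspace.affineSpan_eq_top_iff_vectorSpan_eq_top_of_nonempty ℝ _ _ hne]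
  exact Submodule.eq_top_of_finrank_eq (by rw [Module.finrank_fin_fun]; exact hS)

theorem setDim_le {n : ℕ} (S : Set (Fin n → ℝ)) : setDim S ≤ n :=
  (Submodule.finrank_le _).trans_eq (Module.finrank_fin_fun ℝ)

namespace PolyDesc

variable {n m : ℕ} (D : PolyDesc n m)

theorem le_dist_iff {s : ℝ} {x : Fin n → ℝ} :
    s ≤ D.dist x ↔ ∀ i, (D.b i : ℝ) + s ≤ ipair (D.A i) x := by
  simp [dist, dF, le_sub_iff_add_le']

theorem mem_adj_iff {s : ℝ} {x : Fin n → ℝ} :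
    x ∈ D.adj s ↔ ∀ i, (D.b i : ℝ) + s ≤ ipair (D.A i) x := D.le_dist_iff

theorem continuous_dist : Continuous D.dist :=
  Continuous.finset_inf'_apply _ fun i _ => (continuous_ipair (D.A i)).sub continuous_const

theorem adj_zero : D.adj 0 = D.pts := by
  ext x; simp [mem_adj_iff, pts]

theorem isBounded_adj {s : ℝ} (hs : 0 ≤ s) : Bornology.IsBounded (D.adj s) :=
  D.bounded.subset fun x hx i => by
    have h := D.mem_adj_iff.mp hx i
    linarith

theorem adj_eq_ratPolyhedron (q : ℚ) :
    D.adj q = ratPolyhedron (fun i j => (D.A i j : ℚ)) (fun i => D.b i + q) := by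
  ext x; simp [mem_adj_iff, ratPolyhedron, ipair]

theorem pos_dim (D : PolyDesc n m) : 0 < n := by
  have h := D.facet_dim ⟨0, D.hm⟩
  omega

theorem convex_pts : Convex ℝ D.pts := by
  have h := D.adj_eq_ratPolyhedron 0
  rw [Rat.cast_zero, D.adj_zero] at h
  rw [h]
  exact ratPolyhedron.convex

theorem lt_dist_of_mem_interior_adj {s : ℝ} {y : Fin n → ℝ} (hy : y ∈ interior (D.adj s)) :
    s < D.dist y := by
  have h : ∀ i, s < D.dF i y := fun i => by
    have := lt_ipair_of_mem_interior (D.prim i).1 (fun x hx => D.mem_adj_iff.mp hx i) hy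
    rw [dF]
    linarith
  exact (Finset.lt_inf'_iff _).mpr fun i _ => h i

theorem exists_isMax_dist : ∃ x, 0 < D.dist x ∧ ∀ y, D.dist y ≤ D.dist x := by
  obtain ⟨y, hy⟩ := interior_nonempty_of_setDim_eq D.pos_dim D.convex_pts D.fulldim
  rw [← D.adj_zero] at hy
  have hyd := D.lt_dist_of_mem_interior_adj hy
  have hK : IsCompact (D.adj 0) := Metric.isCompact_of_isClosed_isBounded
    (isClosed_le continuous_const D.continuous_dist) (D.isBounded_adj le_rfl)
  obtain ⟨x, -, hx⟩ := hK.exists_isMaxOn ⟨y, interior_subset hy⟩ D.continuous_dist.continuousOn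
  have hx' : ∀ z ∈ D.adj 0, D.dist z ≤ D.dist x := fun z hz => hx hz
  have hpos := hyd.trans_le (hx' y (interior_subset hy))
  refine ⟨x, hpos, fun z => ?_⟩
  rcases le_total 0 (D.dist z) with h | h
  · exact hx' z h
  · exact h.trans hpos.le

/-- The coefficients of the polyhedron `{(x, s) : 0 ≤ s ≤ d_P(x)}`. -/
def liftCoeff : Option (Fin m) → Option (Fin n) → ℚ
  | none, none => 1
  | none, some _ => 0
  | some _, none => -1
  | some i, some j => D.A i j

/-- The polyhedron `{(x, s) : 0 ≤ s ≤ d_P(x)}`. -/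
def lift : Set (Option (Fin n) → ℝ) := ratPolyhedron D.liftCoeff fun i => i.elim 0 D.b

theorem mem_lift_iff {y : Option (Fin n) → ℝ} :
    y ∈ D.lift ↔ 0 ≤ y none ∧ y none ≤ D.dist fun j => y (some j) := by
  rw [le_dist_iff]
  simp only [lift, ratPolyhedron, Set.mem_ofPred_eq, Option.forall, Fintype.sum_option, liftCoeff,
    ipair, Option.elim_none, Option.elim_some]
  simp only [Rat.cast_zero, Rat.cast_one, one_mul, zero_mul, Finset.sum_const_zero, add_zero,
    Rat.cast_neg, Rat.cast_intCast, neg_one_mul, neg_add_eq_sub, le_sub_iff_add_le]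

theorem isBounded_lift : Bornology.IsBounded D.lift := by
  obtain ⟨x, -, hx⟩ := D.exists_isMax_dist
  obtain ⟨R, hR⟩ := isBounded_iff_forall_norm_le.mp (D.isBounded_adj le_rfl)
  refine isBounded_iff_forall_norm_le.mpr ⟨max R (D.dist x), fun y hy => ?_⟩
  obtain ⟨h0, h1⟩ := D.mem_lift_iff.mp hy
  have hmax : 0 ≤ max R (D.dist x) := (h0.trans (h1.trans (hx _))).trans (le_max_right _ _)
  refine (pi_norm_le_iff_of_nonneg hmax).mpr fun k => ?_
  cases k with
  | none =>
    rw [Real.norm_of_nonneg h0]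
    exact (h1.trans (hx _)).trans (le_max_right _ _)
  | some j =>
    exact (norm_le_pi_norm (fun j => y (some j)) j).trans
      ((hR _ (h0.trans h1)).trans (le_max_left _ _))

/-- The maximal lattice distance to the boundary is rational and attained at a rational point. -/
theorem exists_rat_isMax_dist : ∃ (q : ℚ) (v : Fin n → ℚ), 0 < q ∧
    D.dist (fun j => (v j : ℝ)) = q ∧ ∀ y, D.dist y ≤ q := by
  obtain ⟨x, hpos, hx⟩ := D.exists_isMax_dist
  obtain ⟨V, hV⟩ := ratPolyhedron.exists_eq_convexHull D.isBounded_lift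
  obtain ⟨v, hvV, hv⟩ : ∃ v ∈ V, D.dist x ≤ (v none : ℝ) := by
    by_contra! hlt
    have hconv : Convex ℝ {y : Option (Fin n) → ℝ | y none < D.dist x} :=
      convex_halfSpace_lt (LinearMap.proj (R := ℝ) (φ := fun _ => ℝ) none).isLinear _
    have hsub := convexHull_min (𝕜 := ℝ)
      (s := (fun v : Option (Fin n) → ℚ => fun j => (v j : ℝ)) '' (V : Set _)) (by
        rintro _ ⟨v, hv, rfl⟩
        exact hlt v hv) hconv
    rw [← hV] at hsub
    have hmem : (fun k => k.elim (D.dist x) x) ∈ D.lift := D.mem_lift_iff.mpr ⟨hpos.le, le_rfl⟩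
    exact lt_irrefl (D.dist x) (hsub hmem)
  have hvmem : (fun k => (v k : ℝ)) ∈ D.lift := by
    rw [lift, hV]
    exact subset_convexHull ℝ _ ⟨v, hvV, rfl⟩
  have hle := (D.mem_lift_iff.mp hvmem).2
  refine ⟨v none, fun j => v (some j), by exact_mod_cast hpos.trans_le hv,
    le_antisymm ((hx _).trans hv) hle, fun y => (hx y).trans hv⟩

theorem setDim_adj_eq_of_lt {s : ℝ} {x : Fin n → ℝ} (hs : s < D.dist x) :
    setDim (D.adj s) = n := by
  refine setDim_eq_of_interior_nonempty ⟨x, mem_interior.mpr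
    ⟨{y | s < D.dist y}, fun y (hy : s < D.dist y) => hy.le,
      isOpen_lt continuous_const D.continuous_dist, hs⟩⟩

theorem nonempty_adj_of_setDim_eq {s : ℝ} (hs : setDim (D.adj s) = n) : (D.adj s).Nonempty := by
  by_contra h
  rw [Set.not_nonempty_iff_eq_empty] at h
  rw [h, setDim, vectorSpan_empty, finrank_bot] at hs
  exact D.pos_dim.ne hs

end PolyDesc

/-- The supremum `sup {s > 0 : P⁽ˢ⁾ ≠ ∅}` is attained and is a
positive rational number; it also equals `sup {s > 0 : dim P⁽ˢ⁾ = n}`. Moreover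
`μ(P) = min {p/q : p, q ∈ ℤ_{>0}, (pP)⁽q⁾ ∩ ℤⁿ ≠ ∅}` (note
`(pP)⁽q⁾ = {x : ⟨aᵢ, x⟩ ≥ p bᵢ + q for all i}`), and the core
`core(P) = P^{(1/μ(P))}` is a rational polytope of dimension `< n`. -/
theorem statement2 {n m : ℕ} (D : PolyDesc n m) :
    D.qcdInv ∈ D.qcdInvSet ∧
    (∃ q : ℚ, 0 < q ∧ (q : ℝ) = D.qcdInv) ∧
    D.qcdInv = sSup {s : ℝ | 0 < s ∧ setDim (D.adj s) = n} ∧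
    IsLeast {r : ℝ | ∃ p q : ℤ, 0 < p ∧ 0 < q ∧ r = (p : ℝ) / (q : ℝ) ∧
      ∃ z : Fin n → ℤ, ∀ i,
        (p : ℝ) * (D.b i : ℝ) + (q : ℝ) ≤ ipair (D.A i) (fun j => ((z j : ℝ)))} D.qcd ∧
    (∃ V : Finset (Fin n → ℚ),
      D.core = convexHull ℝ
        ((fun v : Fin n → ℚ => fun j => ((v j : ℝ))) '' (V : Set (Fin n → ℚ)))) ∧
    setDim D.core < n := by
  obtain ⟨q, v, hq, hv, hmax⟩ := D.exists_rat_isMax_dist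
  have hqR : (0 : ℝ) < q := by exact_mod_cast hq
  have hle : ∀ s, (D.adj s).Nonempty → s ≤ q := fun s ⟨y, hy⟩ => le_trans hy (hmax y)
  have hgreatest : IsGreatest D.qcdInvSet (q : ℝ) :=
    ⟨⟨hqR, _, hv.ge⟩, fun s hs => hle s hs.2⟩
  have hinv : D.qcdInv = q := hgreatest.csSup_eq
  have hcore : D.core = D.adj q := by rw [PolyDesc.core, hinv]
  refine ⟨?_, ⟨q, hq, hinv.symm⟩, ?_, ⟨?_, ?_⟩, ?_, ?_⟩
  · rw [hinv]
    exact hgreatest.1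
  · rw [hinv]
    have hmem : ∀ s : ℝ, 0 < s → s < q → s ∈ {s : ℝ | 0 < s ∧ setDim (D.adj s) = n} :=
      fun s h0 h1 => ⟨h0, D.setDim_adj_eq_of_lt (hv.symm ▸ h1)⟩
    refine (csSup_eq_of_forall_le_of_forall_lt_exists_gt (b := (q : ℝ))
      ⟨q / 2, hmem _ (half_pos hqR) (half_lt_self hqR)⟩
      (fun s hs => hle s (D.nonempty_adj_of_setDim_eq hs.2)) fun w hw => ?_).symm
    obtain ⟨s, h1, h2⟩ := exists_between (max_lt hw hqR)
    exact ⟨s, hmem s ((le_max_right _ _).trans_lt h1) h2, (le_max_left _ _).trans_lt h1⟩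
  · obtain ⟨N, hN, z, hz⟩ : ∃ N : ℤ, 0 < N ∧ ∃ z : Fin n → ℤ, ∀ j, (z j : ℚ) = N * v j := by
      refine ⟨∏ j, ((v j).den : ℤ), Finset.prod_pos fun j _ => by exact_mod_cast (v j).den_pos,
        fun j => (∏ k ∈ Finset.univ.erase j, ((v k).den : ℤ)) * (v j).num, fun j => ?_⟩
      rw [← Finset.prod_erase_mul _ _ (Finset.mem_univ j)]
      push_cast
      rw [mul_assoc, Rat.den_mul_eq_num]
    have hnum : (q.den : ℝ) * q = q.num := by exact_mod_cast Rat.den_mul_eq_num q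
    refine ⟨N * q.den, N * q.num, mul_pos hN (by exact_mod_cast q.den_pos),
      mul_pos hN (Rat.num_pos.mpr hq), ?_, fun j => q.den * z j, fun i => ?_⟩
    · have hden : (0 : ℝ) < q.den := by exact_mod_cast q.den_pos
      have hN' : (0 : ℝ) < N := by exact_mod_cast hN
      rw [PolyDesc.qcd, hinv]
      push_cast
      rw [← hnum]
      field_simp
    · have h := D.le_dist_iff.mp hv.ge i
      have hc : (0 : ℝ) ≤ N * q.den := by positivity
      have hz' : ipair (D.A i) (fun j => ((q.den * z j : ℤ) : ℝ))
          = (N * q.den) * ipair (D.A i) (fun j => (v j : ℝ)) := by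
        rw [ipair, ipair, Finset.mul_sum]
        refine Finset.sum_congr rfl fun j _ => ?_
        have hj : (z j : ℝ) = N * v j := by exact_mod_cast hz j
        push_cast
        rw [hj]
        ring
      rw [hz']
      push_cast
      rw [← hnum]
      nlinarith [mul_le_mul_of_nonneg_left h hc]
  · rintro r ⟨p, k, hp, hk, rfl, z, hz⟩
    have hpR : (0 : ℝ) < p := by exact_mod_cast hp
    have hkR : (0 : ℝ) < k := by exact_mod_cast hk
    have hmem : (fun j => (z j : ℝ) / p) ∈ D.adj ((k : ℝ) / p) := by
      refine D.mem_adj_iff.mpr fun i => ?_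
      have h : ipair (D.A i) (fun j => (z j : ℝ) / p)
          = ipair (D.A i) (fun j => (z j : ℝ)) / p := by
        simp only [ipair, Finset.sum_div, mul_div_assoc]
      rw [h, le_div_iff₀ hpR, add_mul, div_mul_cancel₀ _ hpR.ne', mul_comm]
      exact hz i
    rw [PolyDesc.qcd, hinv, ← inv_div]
    exact inv_anti₀ (div_pos hkR hpR) (hle _ ⟨_, hmem⟩)
  · have hb := D.isBounded_adj hqR.le
    rw [hcore]
    rw [D.adj_eq_ratPolyhedron] at hb ⊢
    exact ratPolyhedron.exists_eq_convexHull hb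
  · refine lt_of_le_of_ne (setDim_le _) fun hdim => ?_
    have hconv : Convex ℝ D.core := by
      rw [hcore, D.adj_eq_ratPolyhedron]
      exact ratPolyhedron.convex
    obtain ⟨y, hy⟩ := interior_nonempty_of_setDim_eq D.pos_dim hconv hdim
    rw [hcore] at hy
    exact absurd (hmax y) (D.lt_dist_of_mem_interior_adj hy).not_ge

end
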